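/- arXiv:2005.09361 — 2 statements merged into one kernel-verified Lean document; each statement's English description precedes it below -/
import Mathlib

section
/- There is a constant C≥1, independent of the word and the point, such that for every finite word 𝔦∈𝓘* and every a∈[0,1]², the smaller singular value of the Jacobian satisfies C⁻¹·g_{𝔦,y}(a) ≤ α₂(D_aS_𝔦) ≤ C·g_{𝔦,y}(a). -/
/-!
Setting (Falconer–Fraser–Lee, "L^q-spectra of measures on planar non-conformal attractors"):
a finite family of C^{1+α} skew-product contractions
`S i (x,y) = (f i x, g i (x,y))` of the unit square, satisfying a domination
condition on the (lower triangular) Jacobians.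
-/

open Set Filter Topology MeasureTheory
open scoped Classical ENNReal

noncomputable section

/-- The closed unit square `[0,1]² ⊆ ℝ²`. -/
def unitSq : Set (ℝ × ℝ) := Set.Icc (0:ℝ) 1 ×ˢ Set.Icc (0:ℝ) 1

variable {ι : Type*} [Fintype ι]

/-- The skew-product map `S_i(x,y) = (f_i x, g_i (x,y))`. -/
def Smap (f : ι → ℝ → ℝ) (g : ι → ℝ × ℝ → ℝ) (i : ι) : ℝ × ℝ → ℝ × ℝ :=
  fun a => (f i a.1, g i a)

/-- The composition `S_𝔦 = S_{i₁} ∘ ⋯ ∘ S_{i_k}` along a finite word `𝔦 = [i₁, …, i_k]`. -/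
def Sword (f : ι → ℝ → ℝ) (g : ι → ℝ × ℝ → ℝ) : List ι → ℝ × ℝ → ℝ × ℝ
  | [] => id
  | i :: l => Smap f g i ∘ Sword f g l

/-- The first component `f_𝔦 = f_{i₁} ∘ ⋯ ∘ f_{i_k}` of `S_𝔦` (a function of `x` only). -/
def fword (f : ι → ℝ → ℝ) : List ι → ℝ → ℝ
  | [] => id
  | i :: l => f i ∘ fword f l

/-- Top-left entry `f_{𝔦,x}(a)` of the (lower triangular) Jacobian `D_a S_𝔦`. -/
def fxw (f : ι → ℝ → ℝ) (g : ι → ℝ × ℝ → ℝ) (l : List ι) (a : ℝ × ℝ) : ℝ :=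
  deriv (fun x => (Sword f g l (x, a.2)).1) a.1

/-- Bottom-left entry `g_{𝔦,x}(a)` of the Jacobian `D_a S_𝔦`. -/
def gxw (f : ι → ℝ → ℝ) (g : ι → ℝ × ℝ → ℝ) (l : List ι) (a : ℝ × ℝ) : ℝ :=
  deriv (fun x => (Sword f g l (x, a.2)).2) a.1

/-- Bottom-right entry `g_{𝔦,y}(a)` of the Jacobian `D_a S_𝔦`. -/
def gyw (f : ι → ℝ → ℝ) (g : ι → ℝ × ℝ → ℝ) (l : List ι) (a : ℝ × ℝ) : ℝ :=
  deriv (fun y => (Sword f g l (a.1, y)).2) a.2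

/-- The standing hypotheses: `|𝓘| ≥ 2`; each `S_i(x,y) = (f_i x, g_i(x,y))` maps the unit
square into itself; `f_i, g_i` are `C^{1+α}` contractions (`0 < α ≤ 1`); and the
domination condition `inf f_{i,x} > sup g_{i,y} ≥ inf g_{i,y} ≥ d > 0` holds. -/
structure IFSHyp (f : ι → ℝ → ℝ) (g : ι → ℝ × ℝ → ℝ) (α d : ℝ) : Prop where
  card2 : 2 ≤ Fintype.card ι
  alpha_pos : 0 < α
  alpha_le_one : α ≤ 1
  d_pos : 0 < d
  maps_f : ∀ i, Set.MapsTo (f i) (Set.Icc 0 1) (Set.Icc 0 1)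
  maps_g : ∀ i, Set.MapsTo (g i) unitSq (Set.Icc 0 1)
  diff_f : ∀ i, Differentiable ℝ (f i)
  diff_g : ∀ i, Differentiable ℝ (g i)
  holder_f : ∀ i, ∃ H : ℝ, ∀ x ∈ Set.Icc (0:ℝ) 1, ∀ y ∈ Set.Icc (0:ℝ) 1,
      |deriv (f i) x - deriv (f i) y| ≤ H * |x - y| ^ α
  holder_g : ∀ i, ∃ H : ℝ, ∀ a ∈ unitSq, ∀ b ∈ unitSq,
      ‖fderiv ℝ (g i) a - fderiv ℝ (g i) b‖ ≤ H * ‖a - b‖ ^ α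
  contr_f : ∀ i, ∃ c, 0 ≤ c ∧ c < 1 ∧ ∀ x ∈ Set.Icc (0:ℝ) 1, ∀ y ∈ Set.Icc (0:ℝ) 1,
      |f i x - f i y| ≤ c * |x - y|
  contr_g : ∀ i, ∃ c, 0 ≤ c ∧ c < 1 ∧ ∀ a ∈ unitSq, ∀ b ∈ unitSq,
      |g i a - g i b| ≤ c * ‖a - b‖
  dom : ∀ i, sSup (gyw f g [i] '' unitSq) < sInf (fxw f g [i] '' unitSq)
  dom_d : ∀ i, ∀ a ∈ unitSq, d ≤ gyw f g [i] a

/-- The larger singular value of the lower triangular matrix `A = [[a,0],[b,c]]`, i.e. the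
square root of the larger eigenvalue of `AᵀA`, in explicit closed form. -/
def sv1 (a b c : ℝ) : ℝ :=
  Real.sqrt (((a ^ 2 + b ^ 2 + c ^ 2) +
    Real.sqrt ((a ^ 2 + b ^ 2 + c ^ 2) ^ 2 - 4 * (a * c) ^ 2)) / 2)

/-- The smaller singular value of the lower triangular matrix `A = [[a,0],[b,c]]`, i.e. the
square root of the smaller eigenvalue of `AᵀA`, in explicit closed form. -/
def sv2 (a b c : ℝ) : ℝ :=
  Real.sqrt (((a ^ 2 + b ^ 2 + c ^ 2) -
    Real.sqrt ((a ^ 2 + b ^ 2 + c ^ 2) ^ 2 - 4 * (a * c) ^ 2)) / 2)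

/-- `α₁(D_a S_𝔦)`, the larger singular value of the Jacobian. -/
def alphaOne (f : ι → ℝ → ℝ) (g : ι → ℝ × ℝ → ℝ) (l : List ι) (a : ℝ × ℝ) : ℝ :=
  sv1 (fxw f g l a) (gxw f g l a) (gyw f g l a)

/-- `α₂(D_a S_𝔦)`, the smaller singular value of the Jacobian. -/
def alphaTwo (f : ι → ℝ → ℝ) (g : ι → ℝ × ℝ → ℝ) (l : List ι) (a : ℝ × ℝ) : ℝ :=
  sv2 (fxw f g l a) (gxw f g l a) (gyw f g l a)

/-- `η = sup_{i, a, b} g_{i,y}(a) / f_{i,x}(b)`. -/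
def etaSup (f : ι → ℝ → ℝ) (g : ι → ℝ × ℝ → ℝ) : ℝ :=
  sSup {x : ℝ | ∃ i : ι, ∃ a ∈ unitSq, ∃ b ∈ unitSq, x = gyw f g [i] a / fxw f g [i] b}

/-- `p(𝔦) = p_{i₁} ⋯ p_{i_k}`. -/
def pword (p : ι → ℝ) (l : List ι) : ℝ := (l.map p).prod

/-- `(p_i)` is a probability vector with all entries in `(0,1)`. -/
def ProbVec (p : ι → ℝ) : Prop := (∀ i, 0 < p i ∧ p i < 1) ∧ ∑ i, p i = 1

/-- The `q`-modified singular value function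
`ψ^{s,q}_a(𝔦) = p(𝔦)^q α₁(D_aS_𝔦)^βq α₂(D_aS_𝔦)^(s−βq)` (real exponents). -/
def psiSV (f : ι → ℝ → ℝ) (g : ι → ℝ × ℝ → ℝ) (p : ι → ℝ) (s q βq : ℝ)
    (a : ℝ × ℝ) (l : List ι) : ℝ :=
  pword p l ^ q * alphaOne f g l a ^ βq * alphaTwo f g l a ^ (s - βq)

/-- `Ψ^{s,q}_{a,k} = Σ_{𝔦 ∈ 𝓘^k} ψ^{s,q}_a(𝔦)`. -/
def PsiSum (f : ι → ℝ → ℝ) (g : ι → ℝ × ℝ → ℝ) (p : ι → ℝ) (s q βq : ℝ)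
    (a : ℝ × ℝ) (k : ℕ) : ℝ :=
  ∑ w : Fin k → ι, psiSV f g p s q βq a (List.ofFn w)

/-- The `δ`-stopping `𝓘_{a,δ} = {𝔦 : α₂(D_aS_𝔦) < δ ≤ α₂(D_aS_𝔦̂)}`, where `𝔦̂` drops the
last letter of `𝔦`. -/
def stopping (f : ι → ℝ → ℝ) (g : ι → ℝ × ℝ → ℝ) (a : ℝ × ℝ) (δ : ℝ) : Set (List ι) :=
  {l | l ≠ [] ∧ alphaTwo f g l a < δ ∧ δ ≤ alphaTwo f g l.dropLast a}

/-- `q`-th power moment sum of a measure on `ℝ` over the `δ`-mesh intervals of positive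
measure. -/
def msum1 (ν : Measure ℝ) (q δ : ℝ) : ℝ :=
  ∑' k : ℤ, if 0 < ν (Set.Icc ((k : ℝ) * δ) (((k : ℝ) + 1) * δ)) then
    (ν (Set.Icc ((k : ℝ) * δ) (((k : ℝ) + 1) * δ))).toReal ^ q else 0

/-- `q`-th power moment sum of a measure on `ℝ²` over the `δ`-mesh squares of positive
measure. -/
def msum2 (ν : Measure (ℝ × ℝ)) (q δ : ℝ) : ℝ :=
  ∑' k : ℤ × ℤ,
    if 0 < ν (Set.Icc ((k.1 : ℝ) * δ) (((k.1 : ℝ) + 1) * δ) ×ˢ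
        Set.Icc ((k.2 : ℝ) * δ) (((k.2 : ℝ) + 1) * δ)) then
      (ν (Set.Icc ((k.1 : ℝ) * δ) (((k.1 : ℝ) + 1) * δ) ×ˢ
        Set.Icc ((k.2 : ℝ) * δ) (((k.2 : ℝ) + 1) * δ))).toReal ^ q else 0

/-- Upper `L^q`-spectrum of a measure on `ℝ²`. -/
def upperTau2 (ν : Measure (ℝ × ℝ)) (q : ℝ) : ℝ :=
  limsup (fun δ => Real.log (msum2 ν q δ) / (-Real.log δ)) (𝓝[>] (0:ℝ))

/-- Lower `L^q`-spectrum of a measure on `ℝ²`. -/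
def lowerTau2 (ν : Measure (ℝ × ℝ)) (q : ℝ) : ℝ :=
  liminf (fun δ => Real.log (msum2 ν q δ) / (-Real.log δ)) (𝓝[>] (0:ℝ))

/-- The smaller singular value of a lower triangular matrix whose off-diagonal entry is controlled
by a dominating top-left entry is comparable to the bottom-right entry. -/
theorem sv2_comparable {a b c K : ℝ} (hc : 0 < c) (hca : c ≤ a) (hb : |b| ≤ K * a) :
    (2 + K ^ 2)⁻¹ * c ≤ sv2 a b c ∧ sv2 a b c ≤ (2 + K ^ 2) * c := by
  have ha : 0 < a := hc.trans_le hca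
  have hb2 : b ^ 2 ≤ K ^ 2 * a ^ 2 := by
    rw [← mul_pow, ← sq_abs b]
    exact pow_le_pow_left₀ (abs_nonneg b) hb 2
  have hc2 : c ^ 2 ≤ a ^ 2 := pow_le_pow_left₀ hc.le hca 2
  unfold sv2
  set T := a ^ 2 + b ^ 2 + c ^ 2 with hT
  set D := Real.sqrt (T ^ 2 - 4 * (a * c) ^ 2) with hD
  have hdisc : 0 ≤ T ^ 2 - 4 * (a * c) ^ 2 := by
    have h2 : 2 * (a * c) ≤ T := by nlinarith [sq_nonneg (a - c), sq_nonneg b]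
    have h3 := pow_le_pow_left₀ (by positivity) h2 2
    nlinarith
  have hDsq : D ^ 2 = T ^ 2 - 4 * (a * c) ^ 2 := Real.sq_sqrt hdisc
  have hD0 : 0 ≤ D := Real.sqrt_nonneg _
  have hT0 : 0 < T := by positivity
  have hDT : D ≤ T := abs_le_of_sq_le_sq' (by nlinarith [sq_nonneg (a * c)]) hT0.le |>.2
  have hTa : a ^ 2 ≤ T := by nlinarith [sq_nonneg b, sq_nonneg c]
  have hTK : T ≤ (2 + K ^ 2) * a ^ 2 := by nlinarith
  have hprod : (T - D) / 2 * (T + D) = 2 * a ^ 2 * c ^ 2 := by nlinarith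
  have hK : 2 ≤ 2 + K ^ 2 := by nlinarith [sq_nonneg K]
  set C := 2 + K ^ 2
  have hC0 : 0 < C := by linarith
  constructor
  · apply Real.le_sqrt_of_sq_le
    have h1 : c ^ 2 ≤ C * ((T - D) / 2) := by
      have h4 : (T - D) / 2 * (T + D) ≤ (T - D) / 2 * (2 * (C * a ^ 2)) :=
        mul_le_mul_of_nonneg_left (by linarith) (by linarith)
      refine le_of_mul_le_mul_left ?_ (show 0 < 2 * a ^ 2 by positivity)
      nlinarith
    have h2 : C * ((T - D) / 2) ≤ C ^ 2 * ((T - D) / 2) :=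
      mul_le_mul_of_nonneg_right (by nlinarith) (by linarith)
    rw [mul_pow, inv_pow, inv_mul_le_iff₀ (by positivity)]
    linarith
  · apply Real.sqrt_le_iff.2 ⟨by positivity, ?_⟩
    have h1 : (T - D) / 2 ≤ 2 * c ^ 2 := by
      have h4 : (T - D) / 2 * a ^ 2 ≤ (T - D) / 2 * (T + D) :=
        mul_le_mul_of_nonneg_left (by linarith) (by linarith)
      refine le_of_mul_le_mul_right ?_ (show 0 < a ^ 2 by positivity)
      nlinarith
    have h2 : 2 * c ^ 2 ≤ C ^ 2 * c ^ 2 :=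
      mul_le_mul_of_nonneg_right (by nlinarith) (by positivity)
    rw [mul_pow]
    linarith

theorem fxw_singleton {ι : Type*} (f : ι → ℝ → ℝ) (g : ι → ℝ × ℝ → ℝ) (i : ι) (a : ℝ × ℝ) :
    fxw f g [i] a = deriv (f i) a.1 := rfl

theorem gyw_singleton {ι : Type*} {f : ι → ℝ → ℝ} {g : ι → ℝ × ℝ → ℝ} {i : ι}
    (hg : Differentiable ℝ (g i)) (a : ℝ × ℝ) :
    gyw f g [i] a = fderiv ℝ (g i) a (0, 1) :=
  ((hg a).hasFDerivAt.comp_hasDerivAt a.2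
    ((hasDerivAt_const a.2 a.1).prodMk (hasDerivAt_id a.2))).deriv

theorem IFSHyp.exists_norm_fderiv_le {f : ι → ℝ → ℝ} {g : ι → ℝ × ℝ → ℝ} {α d : ℝ}
    (h : IFSHyp f g α d) (i : ι) : ∃ M, ∀ a ∈ unitSq, ‖fderiv ℝ (g i) a‖ ≤ M := by
  obtain ⟨H, hH⟩ := h.holder_g i
  have h0 : (0 : ℝ × ℝ) ∈ unitSq := ⟨by simp, by simp⟩
  refine ⟨|H| + ‖fderiv ℝ (g i) 0‖, fun a ha => ?_⟩
  have hna : ‖a - 0‖ ≤ 1 := by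
    obtain ⟨⟨_, _⟩, _, _⟩ := ha
    simp only [sub_zero, Prod.norm_def, Real.norm_eq_abs]
    exact max_le (abs_le.2 ⟨by linarith, by assumption⟩) (abs_le.2 ⟨by linarith, by assumption⟩)
  have hpow : ‖a - 0‖ ^ α ≤ 1 := Real.rpow_le_one (norm_nonneg _) hna h.alpha_pos.le
  have hbd : H * ‖a - 0‖ ^ α ≤ |H| :=
    (mul_le_mul_of_nonneg_right (le_abs_self H) (Real.rpow_nonneg (norm_nonneg _) _)).trans
      (mul_le_of_le_one_right (abs_nonneg H) hpow)
  have := norm_sub_norm_le (fderiv ℝ (g i) a) (fderiv ℝ (g i) 0)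
  linarith [hH a ha 0 h0]

theorem IFSHyp.bddBelow_fxw {f : ι → ℝ → ℝ} {g : ι → ℝ × ℝ → ℝ} {α d : ℝ}
    (h : IFSHyp f g α d) (i : ι) : BddBelow (fxw f g [i] '' unitSq) := by
  obtain ⟨H, hH⟩ := h.holder_f i
  refine ⟨deriv (f i) 0 - |H|, ?_⟩
  rintro _ ⟨a, ⟨ha, -⟩, rfl⟩
  have hna : |a.1 - 0| ≤ 1 := by rw [sub_zero, abs_of_nonneg ha.1]; exact ha.2
  have hpow : |a.1 - 0| ^ α ≤ 1 := Real.rpow_le_one (abs_nonneg _) hna h.alpha_pos.le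
  have hbd : H * |a.1 - 0| ^ α ≤ |H| :=
    (mul_le_mul_of_nonneg_right (le_abs_self H) (Real.rpow_nonneg (abs_nonneg _) _)).trans
      (mul_le_of_le_one_right (abs_nonneg H) hpow)
  rw [fxw_singleton]
  linarith [(abs_le.1 (hH a.1 ha 0 (by simp))).1]

theorem IFSHyp.bddAbove_gyw {f : ι → ℝ → ℝ} {g : ι → ℝ × ℝ → ℝ} {α d : ℝ}
    (h : IFSHyp f g α d) (i : ι) : BddAbove (gyw f g [i] '' unitSq) := by
  obtain ⟨M, hM⟩ := h.exists_norm_fderiv_le i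
  refine ⟨M, ?_⟩
  rintro _ ⟨a, ha, rfl⟩
  rw [gyw_singleton (h.diff_g i)]
  have hle := (fderiv ℝ (g i) a).le_opNorm (0, 1)
  rw [show ‖((0, 1) : ℝ × ℝ)‖ = 1 by simp [Prod.norm_def], mul_one] at hle
  exact (le_abs_self _).trans (hle.trans (hM a ha))

/-- Domination makes the cone `|v| ≤ K u` invariant under the Jacobians, for all large `K`. -/
theorem IFSHyp.exists_invariant_cone {f : ι → ℝ → ℝ} {g : ι → ℝ × ℝ → ℝ} {α d : ℝ}
    (h : IFSHyp f g α d) : ∃ K, 0 ≤ K ∧ ∀ i, ∀ a ∈ unitSq,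
      |fderiv ℝ (g i) a (1, 0)| + K * fderiv ℝ (g i) a (0, 1) ≤ K * deriv (f i) a.1 := by
  choose M hM using h.exists_norm_fderiv_le
  obtain ⟨K, hK⟩ := Finite.exists_le fun i =>
    M i / (sInf (fxw f g [i] '' unitSq) - sSup (gyw f g [i] '' unitSq))
  refine ⟨max K 0, le_max_right _ _, fun i a ha => ?_⟩
  have hgap := sub_pos.2 (h.dom i)
  have hMK := (div_le_iff₀ hgap).1 ((hK i).trans (le_max_left K 0))
  have hf := csInf_le (h.bddBelow_fxw i) (mem_image_of_mem _ ha)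
  have hg := le_csSup (h.bddAbove_gyw i) (mem_image_of_mem _ ha)
  have hle := (fderiv ℝ (g i) a).le_opNorm (1, 0)
  rw [show ‖((1, 0) : ℝ × ℝ)‖ = 1 by simp [Prod.norm_def], mul_one, Real.norm_eq_abs] at hle
  rw [← fxw_singleton f g, ← gyw_singleton (f := f) (h.diff_g i)]
  have hmul := mul_le_mul_of_nonneg_left (sub_le_sub hf hg) (le_max_right K 0)
  linarith [hM i a ha]

theorem IFSHyp.fderiv_le_deriv {f : ι → ℝ → ℝ} {g : ι → ℝ × ℝ → ℝ} {α d : ℝ}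
    (h : IFSHyp f g α d) (i : ι) {a : ℝ × ℝ} (ha : a ∈ unitSq) :
    fderiv ℝ (g i) a (0, 1) ≤ deriv (f i) a.1 := by
  rw [← fxw_singleton f g, ← gyw_singleton (f := f) (h.diff_g i)]
  exact (le_csSup (h.bddAbove_gyw i) (mem_image_of_mem _ ha)).trans
    ((h.dom i).le.trans (csInf_le (h.bddBelow_fxw i) (mem_image_of_mem _ ha)))

theorem IFSHyp.Sword_mem {f : ι → ℝ → ℝ} {g : ι → ℝ × ℝ → ℝ} {α d : ℝ}
    (h : IFSHyp f g α d) (l : List ι) {a : ℝ × ℝ} (ha : a ∈ unitSq) :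
    Sword f g l a ∈ unitSq := by
  induction l with
  | nil => exact ha
  | cons i l ih => exact ⟨h.maps_f i ih.1, h.maps_g i ih⟩

/-- The Jacobian of `S_𝔦` exists, is lower triangular with dominating top-left entry, and maps
`(1, 0)` into any cone invariant under the Jacobians of the generators. -/
theorem IFSHyp.exists_jacobian {f : ι → ℝ → ℝ} {g : ι → ℝ × ℝ → ℝ} {α d K : ℝ}
    (h : IFSHyp f g α d) (hK0 : 0 ≤ K)
    (hK : ∀ i, ∀ a ∈ unitSq,
      |fderiv ℝ (g i) a (1, 0)| + K * fderiv ℝ (g i) a (0, 1) ≤ K * deriv (f i) a.1)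
    (l : List ι) {a : ℝ × ℝ} (ha : a ∈ unitSq) :
    ∃ p q r : ℝ, HasDerivAt (fun x => Sword f g l (x, a.2)) (p, q) a.1 ∧
      HasDerivAt (fun y => Sword f g l (a.1, y)) (0, r) a.2 ∧
      0 < r ∧ r ≤ p ∧ |q| ≤ K * p := by
  induction l with
  | nil =>
    exact ⟨1, 0, 1, (hasDerivAt_id a.1).prodMk (hasDerivAt_const a.1 a.2),
      (hasDerivAt_const a.2 a.1).prodMk (hasDerivAt_id a.2), one_pos, le_rfl, by simpa⟩
  | cons i l ih =>
    obtain ⟨p, q, r, hx, hy, hr, hrp, hq⟩ := ih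
    have hb := h.Sword_mem l ha
    set b := Sword f g l a
    have hp : 0 < p := hr.trans_le hrp
    have hS : HasFDerivAt (Smap f g i)
        (((deriv (f i) b.1) • ContinuousLinearMap.fst ℝ ℝ ℝ).prod (fderiv ℝ (g i) b)) b :=
      ((h.diff_f i b.1).hasDerivAt.comp_hasFDerivAt b hasFDerivAt_fst).prodMk
        (h.diff_g i b).hasFDerivAt
    have hd : 0 < fderiv ℝ (g i) b (0, 1) := by
      rw [← gyw_singleton (f := f) (h.diff_g i)]
      exact h.d_pos.trans_le (h.dom_d i b hb)
    have hlin : ∀ u v : ℝ, fderiv ℝ (g i) b (u, v) =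
        u * fderiv ℝ (g i) b (1, 0) + v * fderiv ℝ (g i) b (0, 1) := fun u v => by
      rw [← smul_eq_mul, ← smul_eq_mul, ← map_smul, ← map_smul, ← map_add]
      congr 1
      ext <;> simp
    refine ⟨deriv (f i) b.1 * p, fderiv ℝ (g i) b (p, q), r * fderiv ℝ (g i) b (0, 1),
      ?_, ?_, by positivity, ?_, ?_⟩
    · exact hS.comp_hasDerivAt a.1 hx
    · refine (hS.comp_hasDerivAt a.2 hy).congr_deriv (Prod.ext ?_ ?_)
      · simp
      · simp [hlin 0 r]
    · rw [mul_comm]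
      exact mul_le_mul (h.fderiv_le_deriv i hb) hrp hr.le (hd.le.trans (h.fderiv_le_deriv i hb))
    · rw [hlin]
      refine (abs_add_le _ _).trans ?_
      rw [abs_mul, abs_mul, abs_of_pos hp, abs_of_pos hd]
      have h1 := mul_le_mul_of_nonneg_right hq hd.le
      have h2 := mul_le_mul_of_nonneg_left (hK i b hb) hp.le
      linarith

theorem alphaTwo_comparable_gyw {ι : Type*} [Fintype ι]
    (f : ι → ℝ → ℝ) (g : ι → ℝ × ℝ → ℝ) (α d : ℝ) (h : IFSHyp f g α d) :
    ∃ C : ℝ, 1 ≤ C ∧ ∀ l : List ι, l ≠ [] → ∀ a ∈ unitSq,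
      C⁻¹ * gyw f g l a ≤ alphaTwo f g l a ∧ alphaTwo f g l a ≤ C * gyw f g l a := by
  obtain ⟨K, hK0, hK⟩ := h.exists_invariant_cone
  refine ⟨2 + K ^ 2, by nlinarith [sq_nonneg K], fun l _ a ha => ?_⟩
  obtain ⟨p, q, r, hx, hy, hr, hrp, hq⟩ := h.exists_jacobian hK0 hK l ha
  have hfx : fxw f g l a = p :=
    ((ContinuousLinearMap.fst ℝ ℝ ℝ).hasFDerivAt.comp_hasDerivAt a.1 hx).deriv
  have hgx : gxw f g l a = q :=
    ((ContinuousLinearMap.snd ℝ ℝ ℝ).hasFDerivAt.comp_hasDerivAt a.1 hx).deriv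
  have hgy : gyw f g l a = r :=
    ((ContinuousLinearMap.snd ℝ ℝ ℝ).hasFDerivAt.comp_hasDerivAt a.2 hy).deriv
  rw [alphaTwo, hfx, hgx, hgy]
  exact sv2_comparable hr hrp hq

end
end

section
/- Fix s∈ℝ, q≥0 and β∈ℝ. There exist constants 0<K₁≤K₂ (depending on s, q, β) such that for all k,l∈ℕ and all a∈[0,1]², the sums Ψ^{s,q}_{a,k} = Σ_{𝔦∈𝓘^k} ψ^{s,q}_a(𝔦) satisfy K₁·Ψ^{s,q}_{a,k}·Ψ^{s,q}_{a,l} ≤ Ψ^{s,q}_{a,k+l} ≤ K₂·Ψ^{s,q}_{a,k}·Ψ^{s,q}_{a,l}. -/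
/-!
Setting (Falconer–Fraser–Lee, "L^q-spectra of measures on planar non-conformal attractors"):
a finite family of C^{1+α} skew-product contractions
`S i (x,y) = (f i x, g i (x,y))` of the unit square, satisfying a domination
condition on the (lower triangular) Jacobians.
-/

open Set Filter Topology MeasureTheory
open scoped Classical ENNReal

noncomputable section

variable {ι : Type*} [Fintype ι]

/-- Two positive reals agree up to the multiplicative constant `C`. -/
def Comparable (C x y : ℝ) : Prop := 0 < x ∧ 0 < y ∧ x ≤ C * y ∧ y ≤ C * x

namespace Comparable

variable {C D x y z w : ℝ}

lemma const_pos (h : Comparable C x y) : 0 < C :=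
  pos_of_mul_pos_left (h.1.trans_le h.2.2.1) h.2.1.le

lemma symm (h : Comparable C x y) : Comparable C y x := ⟨h.2.1, h.1, h.2.2.2, h.2.2.1⟩

lemma refl (hx : 0 < x) : Comparable 1 x x := ⟨hx, hx, by simp, by simp⟩

lemma mul (h : Comparable C x y) (h' : Comparable D z w) :
    Comparable (C * D) (x * z) (y * w) := by
  have hC := h.const_pos
  obtain ⟨hx, hy, hxy, hyx⟩ := h
  obtain ⟨hz, hw, hzw, hwz⟩ := h'
  refine ⟨by positivity, by positivity, ?_, ?_⟩
  · calc x * z ≤ (C * y) * (D * w) := mul_le_mul hxy hzw hz.le (by positivity)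
      _ = C * D * (y * w) := by ring
  · calc y * w ≤ (C * x) * (D * z) := mul_le_mul hyx hwz hw.le (by positivity)
      _ = C * D * (x * z) := by ring

lemma trans (h : Comparable C x y) (h' : Comparable D y z) : Comparable (C * D) x z := by
  have hC := h.const_pos
  have hD := h'.const_pos
  obtain ⟨hx, hy, hxy, hyx⟩ := h
  obtain ⟨_, hz, hyz, hzy⟩ := h'
  refine ⟨hx, hz, ?_, ?_⟩
  · calc x ≤ C * y := hxy
      _ ≤ C * (D * z) := by gcongr
      _ = C * D * z := by ring
  · calc z ≤ D * y := hzy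
      _ ≤ D * (C * x) := by gcongr
      _ = C * D * x := by ring

lemma inv (h : Comparable C x y) : Comparable C x⁻¹ y⁻¹ := by
  obtain ⟨hx, hy, hxy, hyx⟩ := h
  refine ⟨by positivity, by positivity, ?_, ?_⟩
  · rw [← div_eq_mul_inv, inv_eq_one_div, div_le_div_iff₀ hx hy]; linarith
  · rw [← div_eq_mul_inv, inv_eq_one_div, div_le_div_iff₀ hy hx]; linarith

lemma rpow (h : Comparable C x y) (t : ℝ) : Comparable (C ^ |t|) (x ^ t) (y ^ t) := by
  have key : ∀ {u v r : ℝ}, 0 ≤ r → Comparable C u v → Comparable (C ^ r) (u ^ r) (v ^ r) := by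
    intro u v r hr h
    have hC := h.const_pos
    obtain ⟨hu, hv, huv, hvu⟩ := h
    refine ⟨by positivity, by positivity, ?_, ?_⟩
    · rw [← Real.mul_rpow hC.le hv.le]; exact Real.rpow_le_rpow hu.le huv hr
    · rw [← Real.mul_rpow hC.le hu.le]; exact Real.rpow_le_rpow hv.le hvu hr
  rcases le_total 0 t with ht | ht
  · rw [abs_of_nonneg ht]; exact key ht h
  · rw [abs_of_nonpos ht]
    have := key (neg_nonneg.2 ht) h.inv
    rwa [Real.inv_rpow h.1.le, Real.inv_rpow h.2.1.le, Real.rpow_neg h.1.le,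
      Real.rpow_neg h.2.1.le, inv_inv, inv_inv] at this

lemma sum {κ : Type*} [Fintype κ] [Nonempty κ] {u v : κ → ℝ}
    (h : ∀ i, Comparable C (u i) (v i)) : Comparable C (∑ i, u i) (∑ i, v i) := by
  refine ⟨Finset.sum_pos (fun i _ => (h i).1) Finset.univ_nonempty,
    Finset.sum_pos (fun i _ => (h i).2.1) Finset.univ_nonempty, ?_, ?_⟩
  · rw [Finset.mul_sum]; exact Finset.sum_le_sum fun i _ => (h i).2.2.1
  · rw [Finset.mul_sum]; exact Finset.sum_le_sum fun i _ => (h i).2.2.2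

end Comparable

section SingularValues

variable {a b c B : ℝ}

lemma singularValue_discrim_nonneg (a b c : ℝ) :
    0 ≤ (a ^ 2 + b ^ 2 + c ^ 2) ^ 2 - 4 * (a * c) ^ 2 := by
  have : (a ^ 2 + b ^ 2 + c ^ 2) ^ 2 - 4 * (a * c) ^ 2 =
      ((a - c) ^ 2 + b ^ 2) * ((a + c) ^ 2 + b ^ 2) := by ring
  rw [this]; positivity

lemma sv1_mul_sv2 (ha : 0 < a) (hc : 0 < c) : sv1 a b c * sv2 a b c = a * c := by
  have hD := singularValue_discrim_nonneg a b c
  rw [sv1, sv2, ← Real.sqrt_mul (by positivity),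
    Real.sqrt_eq_iff_mul_self_eq_of_pos (by positivity)]
  linear_combination (1 / 4 : ℝ) * Real.sq_sqrt hD

lemma comparable_sv1 (hc : 0 < c) (hca : c ≤ a) (hB : 0 ≤ B) (hb : |b| ≤ B * a) :
    Comparable (B + 2) (sv1 a b c) a := by
  have ha : 0 < a := hc.trans_le hca
  have hb2 : b ^ 2 ≤ (B * a) ^ 2 :=
    sq_le_sq' (by linarith [neg_abs_le b]) ((le_abs_self b).trans hb)
  set T := a ^ 2 + b ^ 2 + c ^ 2 with hT
  have hT0 : 0 < T := by positivity
  have hsqrt : Real.sqrt (T ^ 2 - 4 * (a * c) ^ 2) ≤ T := by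
    rw [Real.sqrt_le_left hT0.le]; nlinarith [sq_nonneg (a * c)]
  have hsqrt0 := Real.sqrt_nonneg (T ^ 2 - 4 * (a * c) ^ 2)
  refine ⟨Real.sqrt_pos.2 (by positivity), ha, ?_, ?_⟩
  · rw [sv1, Real.sqrt_le_left (by positivity)]
    nlinarith [mul_nonneg hB (sq_nonneg a), mul_self_le_mul_self hc.le hca]
  · have h1 : a / 2 ≤ sv1 a b c := by
      apply Real.le_sqrt_of_sq_le
      nlinarith [sq_nonneg b, sq_nonneg c]
    nlinarith

lemma comparable_sv2 (hc : 0 < c) (hca : c ≤ a) (hB : 0 ≤ B) (hb : |b| ≤ B * a) :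
    Comparable (B + 2) (sv2 a b c) c := by
  have ha : 0 < a := hc.trans_le hca
  obtain ⟨h1, -, h2, h3⟩ := comparable_sv1 hc hca hB hb
  have hm := sv1_mul_sv2 (b := b) ha hc
  have h0 : 0 < sv2 a b c := pos_of_mul_pos_right (hm ▸ mul_pos ha hc) h1.le
  refine ⟨h0, hc, le_of_mul_le_mul_left ?_ h1, le_of_mul_le_mul_left ?_ ha⟩
  · rw [hm]; nlinarith
  · rw [← hm]; nlinarith

end SingularValues

section Words

variable {κ : Type*} (f : κ → ℝ → ℝ) (g : κ → ℝ × ℝ → ℝ)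

/-- The product of a family of functions `u` along the orbit of `a` under the word `l`. -/
def orbitProd (u : κ → ℝ × ℝ → ℝ) : List κ → ℝ × ℝ → ℝ
  | [], _ => 1
  | i :: l, a => u i (Sword f g l a) * orbitProd u l a

lemma orbitProd_append (u : κ → ℝ × ℝ → ℝ) (l m : List κ) (a : ℝ × ℝ) :
    orbitProd f g u (l ++ m) a = orbitProd f g u l (Sword f g m a) * orbitProd f g u m a := by
  have hS : ∀ l : List κ, Sword f g (l ++ m) a = Sword f g l (Sword f g m a) := by
    intro l
    induction l with
    | nil => rfl
    | cons i l ih => simp [Sword, ih]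
  induction l with
  | nil => simp [orbitProd]
  | cons i l ih => simp [orbitProd, ih, hS, mul_assoc]

lemma Sword_fst (l : List κ) (a : ℝ × ℝ) : (Sword f g l a).1 = fword f l a.1 := by
  induction l with
  | nil => rfl
  | cons i l ih => simp [Sword, fword, Smap, ih]

variable {f g}

lemma differentiable_Sword (hf : ∀ i, Differentiable ℝ (f i)) (hg : ∀ i, Differentiable ℝ (g i))
    (l : List κ) : Differentiable ℝ (Sword f g l) := by
  induction l with
  | nil => exact differentiable_id
  | cons i l ih =>
    have hS : Differentiable ℝ (Smap f g i) :=
      ((hf i).comp differentiable_fst).prodMk (hg i)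
    exact hS.comp ih

lemma fxw_eq_orbitProd (hf : ∀ i, Differentiable ℝ (f i)) (hg : ∀ i, Differentiable ℝ (g i))
    (l : List κ) (a : ℝ × ℝ) :
    fxw f g l a = orbitProd f g (fun i b => deriv (f i) b.1) l a := by
  induction l with
  | nil => simp [fxw, Sword, orbitProd]
  | cons i l ih =>
    rw [orbitProd, ← ih, fxw, fxw]
    have hd : DifferentiableAt ℝ (fun x => (Sword f g l (x, a.2)).1) a.1 := by
      have := differentiable_Sword hf hg l
      fun_prop
    exact deriv_comp a.1 (hf i _) hd

lemma hasDerivAt_Sword_fst_snd (l : List κ) (a : ℝ × ℝ) :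
    HasDerivAt (fun y => (Sword f g l (a.1, y)).1) 0 a.2 := by
  simpa only [Sword_fst] using hasDerivAt_const a.2 (fword f l a.1)

lemma gyw_eq_orbitProd (hf : ∀ i, Differentiable ℝ (f i)) (hg : ∀ i, Differentiable ℝ (g i))
    (l : List κ) (a : ℝ × ℝ) :
    gyw f g l a = orbitProd f g (fun i b => fderiv ℝ (g i) b (0, 1)) l a := by
  induction l with
  | nil => simp [gyw, Sword, orbitProd]
  | cons i l ih =>
    rw [orbitProd, ← ih]
    have hd : HasDerivAt (fun y => (Sword f g l (a.1, y)).2) (gyw f g l a) a.2 := by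
      have := differentiable_Sword hf hg l
      exact DifferentiableAt.hasDerivAt (by fun_prop)
    have hcomp := ((hg i (Sword f g l a)).hasFDerivAt).comp_hasDerivAt_of_eq a.2
      ((hasDerivAt_Sword_fst_snd (f := f) (g := g) l a).prodMk hd) rfl
    have hv : ((0 : ℝ), gyw f g l a) = gyw f g l a • ((0 : ℝ), (1 : ℝ)) := by simp
    rw [hv, map_smul, smul_eq_mul, mul_comm] at hcomp
    exact hcomp.deriv

lemma gxw_cons (hf : ∀ i, Differentiable ℝ (f i)) (hg : ∀ i, Differentiable ℝ (g i))
    (i : κ) (l : List κ) (a : ℝ × ℝ) :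
    gxw f g (i :: l) a = fderiv ℝ (g i) (Sword f g l a) (1, 0) * fxw f g l a +
      fderiv ℝ (g i) (Sword f g l a) (0, 1) * gxw f g l a := by
  have hS := differentiable_Sword hf hg l
  have hd1 : HasDerivAt (fun x => (Sword f g l (x, a.2)).1) (fxw f g l a) a.1 :=
    DifferentiableAt.hasDerivAt (by fun_prop)
  have hd2 : HasDerivAt (fun x => (Sword f g l (x, a.2)).2) (gxw f g l a) a.1 :=
    DifferentiableAt.hasDerivAt (by fun_prop)
  have hcomp := ((hg i (Sword f g l a)).hasFDerivAt).comp_hasDerivAt_of_eq a.1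
    (hd1.prodMk hd2) rfl
  have hv : (fxw f g l a, gxw f g l a) =
      fxw f g l a • ((1 : ℝ), (0 : ℝ)) + gxw f g l a • ((0 : ℝ), (1 : ℝ)) := by simp
  rw [hv, map_add, map_smul, map_smul, smul_eq_mul, smul_eq_mul, mul_comm,
    mul_comm (gxw f g l a)] at hcomp
  exact hcomp.deriv

lemma orbitProd_pos {u : κ → ℝ × ℝ → ℝ} (hS : ∀ l, MapsTo (Sword f g l) unitSq unitSq)
    (hu : ∀ i, ∀ a ∈ unitSq, 0 < u i a) (l : List κ) {a : ℝ × ℝ} (ha : a ∈ unitSq) :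
    0 < orbitProd f g u l a := by
  induction l with
  | nil => exact one_pos
  | cons i l ih => exact mul_pos (hu i _ (hS l ha)) ih

lemma orbitProd_le_orbitProd {u v : κ → ℝ × ℝ → ℝ}
    (hS : ∀ l, MapsTo (Sword f g l) unitSq unitSq) (hu : ∀ i, ∀ a ∈ unitSq, 0 < u i a)
    (huv : ∀ i, ∀ a ∈ unitSq, u i a ≤ v i a) (l : List κ) {a : ℝ × ℝ} (ha : a ∈ unitSq) :
    orbitProd f g u l a ≤ orbitProd f g v l a := by
  induction l with
  | nil => exact le_rfl
  | cons i l ih =>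
    have hb := hS l ha
    exact mul_le_mul (huv i _ hb) ih (orbitProd_pos hS hu l ha).le
      ((hu i _ hb).le.trans (huv i _ hb))

/-- Bounded distortion: Hölder weights bounded away from zero have comparable orbit products
along uniformly contracted orbits. -/
lemma orbitProd_distortion {u : κ → ℝ × ℝ → ℝ} {α d c H : ℝ}
    (hα : 0 < α) (hd : 0 < d) (hH : 0 ≤ H) (hc0 : 0 ≤ c) (hc1 : c < 1)
    (hS : ∀ l, MapsTo (Sword f g l) unitSq unitSq)
    (hcontr : ∀ l, ∀ a ∈ unitSq, ∀ b ∈ unitSq,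
      ‖Sword f g l a - Sword f g l b‖ ≤ c ^ l.length)
    (hu : ∀ i, ∀ a ∈ unitSq, d ≤ u i a)
    (hol : ∀ i, ∀ a ∈ unitSq, ∀ b ∈ unitSq, |u i a - u i b| ≤ H * ‖a - b‖ ^ α) :
    ∃ C, ∀ l, ∀ a ∈ unitSq, ∀ b ∈ unitSq,
      Comparable C (orbitProd f g u l a) (orbitProd f g u l b) := by
  set r := c ^ α with hr
  have hr0 : 0 ≤ r := Real.rpow_nonneg hc0 α
  have hr1 : r < 1 := Real.rpow_lt_one hc0 hc1 hα
  have hr1' : 0 < 1 - r := by linarith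
  set E := H / d / (1 - r) with hE
  have hE0 : 0 ≤ E := by positivity
  have hupos : ∀ i, ∀ a ∈ unitSq, 0 < u i a := fun i a ha => hd.trans_le (hu i a ha)
  have key : ∀ l, ∀ a ∈ unitSq, ∀ b ∈ unitSq, orbitProd f g u l a ≤
      Real.exp (E * (1 - r ^ l.length)) * orbitProd f g u l b := by
    intro l a ha b hb
    induction l with
    | nil => simp [orbitProd]
    | cons i l ih =>
      have ha' := hS l ha
      have hb' := hS l hb
      have hdist : ‖Sword f g l a - Sword f g l b‖ ^ α ≤ r ^ l.length := by
        refine (Real.rpow_le_rpow (norm_nonneg _) (hcontr l a ha b hb) hα.le).trans_eq ?_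
        rw [hr, ← Real.rpow_natCast, ← Real.rpow_natCast, ← Real.rpow_mul hc0,
          ← Real.rpow_mul hc0, mul_comm]
      have hstep : u i (Sword f g l a) ≤
          Real.exp (H / d * r ^ l.length) * u i (Sword f g l b) := by
        have h1 := (le_abs_self _).trans (hol i _ ha' _ hb')
        have h2 : H * ‖Sword f g l a - Sword f g l b‖ ^ α ≤ H * r ^ l.length := by gcongr
        have h3 : H * r ^ l.length ≤ H / d * r ^ l.length * u i (Sword f g l b) := by
          calc H * r ^ l.length = H / d * r ^ l.length * d := by field_simp
            _ ≤ _ := by gcongr; exact hu i _ hb'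
        have h4 := Real.add_one_le_exp (H / d * r ^ l.length)
        have h5 := mul_le_mul_of_nonneg_right h4 (hupos i _ hb').le
        linarith
      have hexp : E * (1 - r ^ (i :: l).length) =
          H / d * r ^ l.length + E * (1 - r ^ l.length) := by
        rw [List.length_cons, hE, pow_succ]; field_simp; ring
      rw [orbitProd, orbitProd, hexp, Real.exp_add]
      calc _ ≤ _ := mul_le_mul hstep ih (orbitProd_pos hS hupos l ha).le
              (mul_nonneg (Real.exp_pos _).le (hupos i _ hb').le)
        _ = _ := by ring
  have key' : ∀ l, ∀ a ∈ unitSq, ∀ b ∈ unitSq, orbitProd f g u l a ≤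
      Real.exp E * orbitProd f g u l b := by
    intro l a ha b hb
    refine (key l a ha b hb).trans
      (mul_le_mul_of_nonneg_right (Real.exp_le_exp.2 ?_) (orbitProd_pos hS hupos l hb).le)
    nlinarith [pow_nonneg hr0 l.length]
  exact ⟨Real.exp E, fun l a ha b hb => ⟨orbitProd_pos hS hupos l ha,
    orbitProd_pos hS hupos l hb, key' l a ha b hb, key' l b hb a ha⟩⟩

end Words

namespace IFSHyp

variable {f : ι → ℝ → ℝ} {g : ι → ℝ × ℝ → ℝ} {α d : ℝ}

lemma nonempty (h : IFSHyp f g α d) : Nonempty ι :=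
  Fintype.card_pos_iff.1 (by have := h.card2; omega)

lemma norm_sub_le_one {a b : ℝ × ℝ} (ha : a ∈ unitSq) (hb : b ∈ unitSq) : ‖a - b‖ ≤ 1 := by
  obtain ⟨⟨h1, h2⟩, h3, h4⟩ := ha
  obtain ⟨⟨h5, h6⟩, h7, h8⟩ := hb
  rw [Prod.norm_def, max_le_iff, Real.norm_eq_abs, Real.norm_eq_abs, abs_le, abs_le]
  simp only [Prod.fst_sub, Prod.snd_sub]
  exact ⟨⟨by linarith, by linarith⟩, by linarith, by linarith⟩

lemma mapsTo_Sword (h : IFSHyp f g α d) (l : List ι) : MapsTo (Sword f g l) unitSq unitSq := by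
  induction l with
  | nil => exact mapsTo_id _
  | cons i l ih =>
    intro a ha
    exact ⟨h.maps_f i (ih ha).1, h.maps_g i (ih ha)⟩

lemma exists_contraction (h : IFSHyp f g α d) : ∃ c, 0 ≤ c ∧ c < 1 ∧
    ∀ l, ∀ a ∈ unitSq, ∀ b ∈ unitSq, ‖Sword f g l a - Sword f g l b‖ ≤ c ^ l.length := by
  have := h.nonempty
  choose cf hf0 hf1 hf using h.contr_f
  choose cg hg0 hg1 hg using h.contr_g
  obtain ⟨i₀, hi₀⟩ := Finite.exists_max fun i => max (cf i) (cg i)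
  set c := max (cf i₀) (cg i₀) with hc
  have hc0 : 0 ≤ c := (hf0 i₀).trans (le_max_left _ _)
  refine ⟨c, hc0, max_lt (hf1 i₀) (hg1 i₀), fun l a ha b hb => ?_⟩
  induction l with
  | nil => simpa [Sword] using norm_sub_le_one ha hb
  | cons i l ih =>
    have ha' := h.mapsTo_Sword l ha
    have hb' := h.mapsTo_Sword l hb
    have hle : ‖Sword f g (i :: l) a - Sword f g (i :: l) b‖ ≤
        c * ‖Sword f g l a - Sword f g l b‖ := by
      rw [Prod.norm_def, max_le_iff]
      constructor
      · refine (hf i _ ha'.1 _ hb'.1).trans ?_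
        exact mul_le_mul ((le_max_left _ _).trans (hi₀ i))
          (norm_fst_le (Sword f g l a - Sword f g l b)) (abs_nonneg _) hc0
      · refine (hg i _ ha' _ hb').trans ?_
        exact mul_le_mul_of_nonneg_right ((le_max_right _ _).trans (hi₀ i)) (norm_nonneg _)
    rw [List.length_cons, pow_succ']
    exact hle.trans (mul_le_mul_of_nonneg_left ih hc0)

lemma fxw_singleton (h : IFSHyp f g α d) (i : ι) (a : ℝ × ℝ) :
    fxw f g [i] a = deriv (f i) a.1 := by
  simp [fxw_eq_orbitProd h.diff_f h.diff_g, orbitProd, Sword]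

lemma gyw_singleton (h : IFSHyp f g α d) (i : ι) (a : ℝ × ℝ) :
    gyw f g [i] a = fderiv ℝ (g i) a (0, 1) := by
  simp [gyw_eq_orbitProd h.diff_f h.diff_g, orbitProd, Sword]

lemma exists_holder_f (h : IFSHyp f g α d) : ∃ H, 0 ≤ H ∧ ∀ i, ∀ a ∈ unitSq, ∀ b ∈ unitSq,
    |deriv (f i) a.1 - deriv (f i) b.1| ≤ H * ‖a - b‖ ^ α := by
  have := h.nonempty
  choose H hH using h.holder_f
  obtain ⟨i₀, hi₀⟩ := Finite.exists_max H
  refine ⟨max 0 (H i₀), le_max_left _ _, fun i a ha b hb => (hH i _ ha.1 _ hb.1).trans ?_⟩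
  exact mul_le_mul ((hi₀ i).trans (le_max_right _ _))
    (Real.rpow_le_rpow (abs_nonneg _) (norm_fst_le (a - b)) h.alpha_pos.le)
    (Real.rpow_nonneg (abs_nonneg _) _) (le_max_left _ _)

lemma exists_holder_g (h : IFSHyp f g α d) : ∃ H, 0 ≤ H ∧ ∀ i, ∀ a ∈ unitSq, ∀ b ∈ unitSq,
    ‖fderiv ℝ (g i) a - fderiv ℝ (g i) b‖ ≤ H * ‖a - b‖ ^ α := by
  have := h.nonempty
  choose H hH using h.holder_g
  obtain ⟨i₀, hi₀⟩ := Finite.exists_max H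
  refine ⟨max 0 (H i₀), le_max_left _ _, fun i a ha b hb => (hH i _ ha _ hb).trans ?_⟩
  exact mul_le_mul_of_nonneg_right ((hi₀ i).trans (le_max_right _ _))
    (Real.rpow_nonneg (norm_nonneg _) _)

lemma norm_fderiv_apply_le (L : ℝ × ℝ →L[ℝ] ℝ) (v : ℝ × ℝ) (hv : ‖v‖ ≤ 1) : |L v| ≤ ‖L‖ := by
  simpa using L.le_of_opNorm_le_of_le le_rfl hv

lemma exists_bound_fderiv (h : IFSHyp f g α d) : ∃ M, ∀ i, ∀ a ∈ unitSq,
    ‖fderiv ℝ (g i) a‖ ≤ M := by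
  have := h.nonempty
  obtain ⟨H, hH0, hH⟩ := h.exists_holder_g
  have h0 : ((0 : ℝ), (0 : ℝ)) ∈ unitSq := by simp [unitSq]
  obtain ⟨i₀, hi₀⟩ := Finite.exists_max fun i => ‖fderiv ℝ (g i) (0, 0)‖
  refine ⟨H + ‖fderiv ℝ (g i₀) (0, 0)‖, fun i a ha => ?_⟩
  have h1 : ‖a - (0, 0)‖ ^ α ≤ 1 :=
    Real.rpow_le_one (norm_nonneg _) (norm_sub_le_one ha h0) h.alpha_pos.le
  have h2 := norm_sub_norm_le (fderiv ℝ (g i) a) (fderiv ℝ (g i) (0, 0))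
  have h3 := hH i a ha _ h0
  have h4 := hi₀ i
  nlinarith

lemma exists_domination (h : IFSHyp f g α d) : ∃ η, 0 ≤ η ∧ η < 1 ∧
    ∀ i, ∀ a ∈ unitSq, fderiv ℝ (g i) a (0, 1) ≤ η * deriv (f i) a.1 := by
  have := h.nonempty
  obtain ⟨M, hM⟩ := h.exists_bound_fderiv
  have h0 : ((0 : ℝ), (0 : ℝ)) ∈ unitSq := by simp [unitSq]
  have hbg : ∀ i, BddAbove (gyw f g [i] '' unitSq) := by
    intro i
    refine ⟨M, ?_⟩
    rintro _ ⟨a, ha, rfl⟩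
    rw [h.gyw_singleton]
    exact (le_abs_self _).trans ((norm_fderiv_apply_le _ _ (by simp)).trans (hM i a ha))
  obtain ⟨H, hH0, hH⟩ := h.exists_holder_f
  have hbf : ∀ i, BddBelow (fxw f g [i] '' unitSq) := by
    intro i
    refine ⟨deriv (f i) 0 - H, ?_⟩
    rintro _ ⟨a, ha, rfl⟩
    rw [h.fxw_singleton]
    have h1 : ‖a - (0, 0)‖ ^ α ≤ 1 :=
      Real.rpow_le_one (norm_nonneg _) (norm_sub_le_one ha h0) h.alpha_pos.le
    have h2 := (abs_le.1 (hH i a ha _ h0)).1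
    nlinarith
  have hex : ∀ i, ∃ η, 0 ≤ η ∧ η < 1 ∧
      ∀ a ∈ unitSq, fderiv ℝ (g i) a (0, 1) ≤ η * deriv (f i) a.1 := by
    intro i
    have hG : ∀ a ∈ unitSq, gyw f g [i] a ≤ sSup (gyw f g [i] '' unitSq) :=
      fun a ha => le_csSup (hbg i) ⟨a, ha, rfl⟩
    have hF : ∀ a ∈ unitSq, sInf (fxw f g [i] '' unitSq) ≤ fxw f g [i] a :=
      fun a ha => csInf_le (hbf i) ⟨a, ha, rfl⟩
    have hG0 : 0 < sSup (gyw f g [i] '' unitSq) :=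
      (h.d_pos.trans_le (h.dom_d i _ h0)).trans_le (hG _ h0)
    have hF0 := hG0.trans (h.dom i)
    refine ⟨sSup (gyw f g [i] '' unitSq) / sInf (fxw f g [i] '' unitSq), by positivity,
      (div_lt_one hF0).2 (h.dom i), fun a ha => ?_⟩
    rw [← h.gyw_singleton, ← h.fxw_singleton]
    calc gyw f g [i] a ≤ sSup (gyw f g [i] '' unitSq) := hG a ha
      _ = sSup (gyw f g [i] '' unitSq) / sInf (fxw f g [i] '' unitSq) *
          sInf (fxw f g [i] '' unitSq) := by field_simp
      _ ≤ _ := by gcongr; exact hF a ha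
  choose η hη0 hη1 hη using hex
  obtain ⟨i₀, hi₀⟩ := Finite.exists_max η
  refine ⟨η i₀, hη0 i₀, hη1 i₀, fun i a ha => (hη i a ha).trans ?_⟩
  have hgpos : 0 < fderiv ℝ (g i) a (0, 1) := by
    rw [← h.gyw_singleton]; exact h.d_pos.trans_le (h.dom_d i a ha)
  have hfpos : 0 < deriv (f i) a.1 :=
    pos_of_mul_pos_right (hgpos.trans_le (hη i a ha)) (hη0 i)
  exact mul_le_mul_of_nonneg_right (hi₀ i) hfpos.le

lemma le_fderiv_g (h : IFSHyp f g α d) (i : ι) {a : ℝ × ℝ} (ha : a ∈ unitSq) :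
    d ≤ fderiv ℝ (g i) a (0, 1) := by
  rw [← h.gyw_singleton]; exact h.dom_d i a ha

lemma fderiv_g_le_deriv_f (h : IFSHyp f g α d) (i : ι) {a : ℝ × ℝ} (ha : a ∈ unitSq) :
    fderiv ℝ (g i) a (0, 1) ≤ deriv (f i) a.1 := by
  obtain ⟨η, hη0, hη1, hη⟩ := h.exists_domination
  have h1 := hη i a ha
  have h2 := h.d_pos.trans_le (h.le_fderiv_g i ha)
  have h3 : 0 < deriv (f i) a.1 := pos_of_mul_pos_right (h2.trans_le h1) hη0
  nlinarith

lemma le_deriv_f (h : IFSHyp f g α d) (i : ι) {a : ℝ × ℝ} (ha : a ∈ unitSq) :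
    d ≤ deriv (f i) a.1 :=
  (h.le_fderiv_g i ha).trans (h.fderiv_g_le_deriv_f i ha)

lemma gyw_pos (h : IFSHyp f g α d) (l : List ι) {a : ℝ × ℝ} (ha : a ∈ unitSq) :
    0 < gyw f g l a := by
  rw [gyw_eq_orbitProd h.diff_f h.diff_g]
  exact orbitProd_pos h.mapsTo_Sword (fun i b hb => h.d_pos.trans_le (h.le_fderiv_g i hb)) l ha

lemma gyw_le_fxw (h : IFSHyp f g α d) (l : List ι) {a : ℝ × ℝ} (ha : a ∈ unitSq) :
    gyw f g l a ≤ fxw f g l a := by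
  rw [gyw_eq_orbitProd h.diff_f h.diff_g, fxw_eq_orbitProd h.diff_f h.diff_g]
  exact orbitProd_le_orbitProd h.mapsTo_Sword
    (fun i b hb => h.d_pos.trans_le (h.le_fderiv_g i hb))
    (fun i b hb => h.fderiv_g_le_deriv_f i hb) l ha

lemma exists_gxw_bound (h : IFSHyp f g α d) : ∃ B, 0 ≤ B ∧ ∀ l, ∀ a ∈ unitSq,
    |gxw f g l a| ≤ B * fxw f g l a := by
  obtain ⟨M, hM⟩ := h.exists_bound_fderiv
  obtain ⟨η, hη0, hη1, hη⟩ := h.exists_domination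
  have hd := h.d_pos
  have hη1' : 0 < 1 - η := by linarith
  have hM0 : 0 ≤ M := by
    obtain ⟨i⟩ := h.nonempty
    exact (norm_nonneg _).trans (hM i (0, 0) (by simp [unitSq]))
  set B := M / d / (1 - η) with hB
  have hB0 : 0 ≤ B := by positivity
  have hBe : M / d + η * B = B := by rw [hB]; field_simp; ring
  refine ⟨B, hB0, fun l a ha => ?_⟩
  induction l with
  | nil => simpa [gxw, fxw, Sword] using hB0
  | cons i l ih =>
    have hb := h.mapsTo_Sword l ha
    have hF : 0 < fxw f g l a := (h.gyw_pos l ha).trans_le (h.gyw_le_fxw l ha)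
    have hfx : fxw f g (i :: l) a = deriv (f i) (Sword f g l a).1 * fxw f g l a := by
      simp only [fxw_eq_orbitProd h.diff_f h.diff_g, orbitProd]
    rw [gxw_cons h.diff_f h.diff_g, hfx]
    set b := Sword f g l a
    have hfd := h.le_deriv_f i hb
    have hgd := h.d_pos.trans_le (h.le_fderiv_g i hb)
    have h1 : |fderiv ℝ (g i) b (1, 0)| ≤ M / d * deriv (f i) b.1 :=
      calc |fderiv ℝ (g i) b (1, 0)| ≤ M :=
            (norm_fderiv_apply_le _ _ (by simp)).trans (hM i b hb)
        _ = M / d * d := by field_simp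
        _ ≤ _ := by gcongr
    calc |fderiv ℝ (g i) b (1, 0) * fxw f g l a + fderiv ℝ (g i) b (0, 1) * gxw f g l a|
        ≤ |fderiv ℝ (g i) b (1, 0)| * fxw f g l a +
            fderiv ℝ (g i) b (0, 1) * |gxw f g l a| := by
          refine (abs_add_le _ _).trans_eq ?_
          rw [abs_mul, abs_mul, abs_of_pos hF, abs_of_pos hgd]
      _ ≤ M / d * deriv (f i) b.1 * fxw f g l a +
            η * deriv (f i) b.1 * (B * fxw f g l a) := by
          refine add_le_add (mul_le_mul_of_nonneg_right h1 hF.le) ?_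
          exact mul_le_mul (hη i b hb) ih (abs_nonneg _)
            (mul_nonneg hη0 (hd.le.trans hfd))
      _ = (M / d + η * B) * (deriv (f i) b.1 * fxw f g l a) := by ring
      _ = B * (deriv (f i) b.1 * fxw f g l a) := by rw [hBe]

lemma exists_alpha_comparable (h : IFSHyp f g α d) : ∃ C, ∀ l, ∀ a ∈ unitSq,
    Comparable C (alphaOne f g l a) (fxw f g l a) ∧
      Comparable C (alphaTwo f g l a) (gyw f g l a) := by
  obtain ⟨B, hB0, hB⟩ := h.exists_gxw_bound
  exact ⟨B + 2, fun l a ha =>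
    ⟨comparable_sv1 (h.gyw_pos l ha) (h.gyw_le_fxw l ha) hB0 (hB l a ha),
      comparable_sv2 (h.gyw_pos l ha) (h.gyw_le_fxw l ha) hB0 (hB l a ha)⟩⟩

lemma exists_orbitProd_append_comparable (h : IFSHyp f g α d) {u : ι → ℝ × ℝ → ℝ} {H : ℝ}
    (hH : 0 ≤ H) (hu : ∀ i, ∀ a ∈ unitSq, d ≤ u i a)
    (hol : ∀ i, ∀ a ∈ unitSq, ∀ b ∈ unitSq, |u i a - u i b| ≤ H * ‖a - b‖ ^ α) :
    ∃ C, ∀ l m, ∀ a ∈ unitSq, Comparable C (orbitProd f g u (l ++ m) a)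
      (orbitProd f g u l a * orbitProd f g u m a) := by
  obtain ⟨c, hc0, hc1, hc⟩ := h.exists_contraction
  obtain ⟨C, hC⟩ := orbitProd_distortion h.alpha_pos h.d_pos hH hc0 hc1 h.mapsTo_Sword hc hu hol
  refine ⟨C * 1, fun l m a ha => ?_⟩
  rw [orbitProd_append]
  exact (hC l _ (h.mapsTo_Sword m ha) a ha).mul (Comparable.refl
    (orbitProd_pos h.mapsTo_Sword (fun i b hb => h.d_pos.trans_le (hu i b hb)) m ha))

lemma exists_fxw_append_comparable (h : IFSHyp f g α d) : ∃ C, ∀ l m, ∀ a ∈ unitSq,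
    Comparable C (fxw f g (l ++ m) a) (fxw f g l a * fxw f g m a) := by
  obtain ⟨H, hH0, hH⟩ := h.exists_holder_f
  simp only [fxw_eq_orbitProd h.diff_f h.diff_g]
  exact h.exists_orbitProd_append_comparable hH0 (fun i a ha => h.le_deriv_f i ha) hH

lemma exists_gyw_append_comparable (h : IFSHyp f g α d) : ∃ C, ∀ l m, ∀ a ∈ unitSq,
    Comparable C (gyw f g (l ++ m) a) (gyw f g l a * gyw f g m a) := by
  obtain ⟨H, hH0, hH⟩ := h.exists_holder_g
  simp only [gyw_eq_orbitProd h.diff_f h.diff_g]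
  refine h.exists_orbitProd_append_comparable hH0 (fun i a ha => h.le_fderiv_g i ha)
    fun i a ha b hb => ?_
  rw [← sub_apply]
  exact (norm_fderiv_apply_le _ _ (by simp)).trans (hH i a ha b hb)

/-- The singular value function is almost multiplicative along concatenation of words. -/
lemma exists_psiSV_append_comparable (h : IFSHyp f g α d) {p : ι → ℝ} (hp : ProbVec p)
    (s q βq : ℝ) : ∃ C, ∀ l m, ∀ a ∈ unitSq,
      Comparable C (psiSV f g p s q βq a (l ++ m))
        (psiSV f g p s q βq a l * psiSV f g p s q βq a m) := by
  obtain ⟨A, hA⟩ := h.exists_alpha_comparable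
  obtain ⟨C₁, hC₁⟩ := h.exists_fxw_append_comparable
  obtain ⟨C₂, hC₂⟩ := h.exists_gyw_append_comparable
  have hpw : ∀ l, 0 < pword p l := fun l => List.prod_pos (by simpa using fun i _ => (hp.1 i).1)
  refine ⟨1 * (A * C₁ * (A * A)) ^ |βq| * (A * C₂ * (A * A)) ^ |s - βq|, fun l m a ha => ?_⟩
  have h₁ := (((hA (l ++ m) a ha).1.trans (hC₁ l m a ha)).trans
    ((hA l a ha).1.symm.mul (hA m a ha).1.symm)).rpow βq
  have h₂ := (((hA (l ++ m) a ha).2.trans (hC₂ l m a ha)).trans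
    ((hA l a ha).2.symm.mul (hA m a ha).2.symm)).rpow (s - βq)
  have h₀ := Comparable.refl (Real.rpow_pos_of_pos (hpw (l ++ m)) q)
  convert (h₀.mul h₁).mul h₂ using 1
  · rfl
  rw [Real.mul_rpow (hA l a ha).1.1.le (hA m a ha).1.1.le,
    Real.mul_rpow (hA l a ha).2.1.le (hA m a ha).2.1.le]
  have hpa : pword p (l ++ m) = pword p l * pword p m := by simp [pword]
  rw [hpa, Real.mul_rpow (hpw l).le (hpw m).le, psiSV, psiSV]
  ring

end IFSHyp

lemma PsiSum_add (f : ι → ℝ → ℝ) (g : ι → ℝ × ℝ → ℝ) (p : ι → ℝ) (s q βq : ℝ) (a : ℝ × ℝ)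
    (k l : ℕ) : PsiSum f g p s q βq a (k + l) =
      ∑ w : (Fin k → ι) × (Fin l → ι),
        psiSV f g p s q βq a (List.ofFn w.1 ++ List.ofFn w.2) := by
  rw [PsiSum, ← (Fin.appendEquiv k l).sum_comp]
  exact Finset.sum_congr rfl fun w _ => by simp [Fin.appendEquiv, List.ofFn_fin_append]

theorem PsiSum_almost_multiplicative {ι : Type*} [Fintype ι]
    (f : ι → ℝ → ℝ) (g : ι → ℝ × ℝ → ℝ) (α d : ℝ) (h : IFSHyp f g α d)
    (p : ι → ℝ) (hp : ProbVec p) (s q βq : ℝ) (hq : 0 ≤ q) :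
    ∃ K₁ K₂ : ℝ, 0 < K₁ ∧ K₁ ≤ K₂ ∧
      ∀ k l : ℕ, 1 ≤ k → 1 ≤ l → ∀ a ∈ unitSq,
        K₁ * (PsiSum f g p s q βq a k * PsiSum f g p s q βq a l) ≤ PsiSum f g p s q βq a (k + l) ∧
        PsiSum f g p s q βq a (k + l) ≤ K₂ * (PsiSum f g p s q βq a k * PsiSum f g p s q βq a l) := by
  have := h.nonempty
  obtain ⟨C, hC⟩ := h.exists_psiSV_append_comparable hp s q βq
  have hsum : ∀ k l : ℕ, ∀ a ∈ unitSq, Comparable C (PsiSum f g p s q βq a (k + l))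
      (PsiSum f g p s q βq a k * PsiSum f g p s q βq a l) := by
    intro k l a ha
    rw [PsiSum_add, PsiSum, PsiSum, Fintype.sum_mul_sum, ← Fintype.sum_prod_type']
    exact Comparable.sum fun w => hC _ _ a ha
  refine ⟨(max C 1)⁻¹, max C 1, by positivity,
    (inv_le_one_of_one_le₀ (le_max_right _ _)).trans (le_max_right _ _),
    fun k l _ _ a ha => ?_⟩
  obtain ⟨h1, h2, h3, h4⟩ := hsum k l a ha
  constructor
  · rw [inv_mul_le_iff₀ (by positivity)]
    exact h4.trans (mul_le_mul_of_nonneg_right (le_max_left _ _) h1.le)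
  · exact h3.trans (mul_le_mul_of_nonneg_right (le_max_left _ _) h2.le)

end
end
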